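/- arXiv:2210.10703 — 2 statements merged into one kernel-verified Lean document; each statement's English description precedes it below -/
import Mathlib

section
/- Proposition 3 (score-bounded selection increases AUC): Assume n⁺ ≥ 1, n⁻ ≥ 1, u := ⌊AUC · p⁻ · n⌋ ≥ 1 and k := ⌊AUC · n⁺⌋ ≥ 1. Let θ_u be the u-th smallest of the n scores and let θ_l be the k-th largest among the scores of the positive instances (these realize the empirical quantiles q̂_n(AUC · p⁻) over all scores and q̂_{n⁺}(AUC − 1/n⁺) over the positive scores). Define the selection function g by g(i) = 0 if θ_l ≤ s(i) ≤ θ_u and g(i) = 1 otherwise. Assume the accepted set {i : g(i) = 1} contains at least one positive and at least one negative instance. Then the empirical AUC computed on the accepted instances is greater than or equal to the empirical AUC of the full sample, and the inequality is strict if at least one instance i has g(i) = 0. -/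
open Finset

variable {ι : Type*}

/-- The set of positive instances (label 1) in the sample `S`. -/
noncomputable def posSet (S : Finset ι) (y : ι → Bool) : Finset ι :=
  S.filter (fun i => y i = true)

/-- The set of negative instances (label 0) in the sample `S`. -/
noncomputable def negSet (S : Finset ι) (y : ι → Bool) : Finset ι :=
  S.filter (fun i => y i = false)

/-- The Mann–Whitney count: number of (positive, negative) pairs ranked correctly. -/
noncomputable def mwCount (S : Finset ι) (s : ι → ℝ) (y : ι → Bool) : ℕ :=
  ((S ×ˢ S).filter (fun p => y p.1 = true ∧ y p.2 = false ∧ s p.2 < s p.1)).card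

/-- The empirical AUC (Mann–Whitney statistic) of the sample `S`. -/
noncomputable def auc (S : Finset ι) (s : ι → ℝ) (y : ι → Bool) : ℝ :=
  (mwCount S s y : ℝ) / (((posSet S y).card : ℝ) * ((negSet S y).card : ℝ))

/-- The rank of `i` in non-descending score order: `#{j ∈ S : s j ≤ s i}`. -/
noncomputable def rank' (S : Finset ι) (s : ι → ℝ) (i : ι) : ℕ :=
  (S.filter (fun j => s j ≤ s i)).card

/-- `t(i)`: the number of positive instances with score at least `s i`. -/
noncomputable def tcount (S : Finset ι) (s : ι → ℝ) (y : ι → Bool) (i : ι) : ℕ :=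
  (S.filter (fun j => y j = true ∧ s i ≤ s j)).card

theorem mwCount_eq_sum (S : Finset ι) (s : ι → ℝ) (y : ι → Bool) :
    mwCount S s y = ∑ i ∈ posSet S y, ∑ j ∈ negSet S y, if s j < s i then 1 else 0 := by
  rw [← Finset.sum_product', ← Finset.card_filter]
  unfold mwCount posSet negSet
  congr 1
  ext ⟨i, j⟩
  simp only [Finset.mem_filter, Finset.mem_product]
  tauto

theorem mwCount_le_card_mul_card (S : Finset ι) (s : ι → ℝ) (y : ι → Bool) :
    mwCount S s y ≤ (posSet S y).card * (negSet S y).card := by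
  rw [mwCount_eq_sum, ← Finset.sum_product', ← Finset.card_filter, ← Finset.card_product]
  exact Finset.card_filter_le _ _

theorem auc_le_one (S : Finset ι) (s : ι → ℝ) (y : ι → Bool) : auc S s y ≤ 1 :=
  div_le_one_of_le₀ (by exact_mod_cast mwCount_le_card_mul_card S s y) (by positivity)

/-- A positive instance in the score band `[θl, θu]` beats few of the negative instances outside
the band: together with all negatives in the band and the instance itself, they fit below `θu`. -/
theorem card_neg_below_add_le_rank' [DecidableEq ι] (S : Finset ι) (s : ι → ℝ) (y : ι → Bool)
    (θl : ℝ) (iu i : ι) (hi : i ∈ posSet (S.filter fun i => θl ≤ s i ∧ s i ≤ s iu) y) :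
    ((negSet (S.filter fun i => ¬ (θl ≤ s i ∧ s i ≤ s iu)) y).filter fun j => s j < s i).card
      + (negSet (S.filter fun i => θl ≤ s i ∧ s i ≤ s iu) y).card + 1 ≤ rank' S s iu := by
  simp only [posSet, Finset.mem_filter] at hi
  obtain ⟨⟨hiS, hil, hiu⟩, hy⟩ := hi
  rw [← Finset.card_union_of_disjoint, ← Finset.card_singleton i,
    ← Finset.card_union_of_disjoint]
  · apply Finset.card_le_card
    intro j hj
    simp only [negSet, Finset.mem_union, Finset.mem_filter, Finset.mem_singleton] at hj ⊢
    rcases hj with (⟨⟨⟨hS, _⟩, _⟩, hlt⟩ | ⟨⟨hS, _, hle⟩, _⟩) | rfl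
    · exact ⟨hS, hlt.le.trans hiu⟩
    · exact ⟨hS, hle⟩
    · exact ⟨hiS, hiu⟩
  · simp [negSet, hy]
  · rw [Finset.disjoint_left]
    simp only [negSet, Finset.mem_filter]
    tauto

/-- A negative instance with score at least `s il` is beaten by at most `t(il)` positives. -/
theorem card_pos_above_le_tcount (S : Finset ι) (s : ι → ℝ) (y : ι → Bool) (il j : ι)
    (hj : s il ≤ s j) :
    ((posSet S y).filter fun i => s j < s i).card ≤ tcount S s y il := by
  apply Finset.card_le_card
  intro i
  simp only [posSet, Finset.mem_filter]
  exact fun h => ⟨h.1.1, h.1.2, hj.trans h.2.le⟩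

theorem card_posSet_filter_add (S : Finset ι) (y : ι → Bool) (p : ι → Prop) [DecidablePred p] :
    (posSet (S.filter p) y).card + (posSet (S.filter fun i => ¬ p i) y).card
      = (posSet S y).card := by
  unfold posSet
  rw [Finset.filter_comm, Finset.filter_comm (fun i => ¬ p i)]
  exact Finset.card_filter_add_card_filter_not p

theorem sum_posSet_filter_add (S : Finset ι) (y : ι → Bool) (p : ι → Prop) [DecidablePred p]
    (f : ι → ℕ) :
    ∑ i ∈ posSet (S.filter p) y, f i + ∑ i ∈ posSet (S.filter fun i => ¬ p i) y, f i
      = ∑ i ∈ posSet S y, f i := by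
  unfold posSet
  rw [Finset.filter_comm, Finset.filter_comm (fun i => ¬ p i)]
  exact Finset.sum_filter_add_sum_filter_not _ p f

theorem sum_negSet_filter_add (S : Finset ι) (y : ι → Bool) (p : ι → Prop) [DecidablePred p]
    (f : ι → ℕ) :
    ∑ i ∈ negSet (S.filter p) y, f i + ∑ i ∈ negSet (S.filter fun i => ¬ p i) y, f i
      = ∑ i ∈ negSet S y, f i := by
  unfold negSet
  rw [Finset.filter_comm, Finset.filter_comm (fun i => ¬ p i)]
  exact Finset.sum_filter_add_sum_filter_not _ p f

/-- Decomposition of the Mann–Whitney count along a partition of the sample. -/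
theorem mwCount_eq_filter_add (S : Finset ι) (s : ι → ℝ) (y : ι → Bool) (p : ι → Prop)
    [DecidablePred p] :
    mwCount S s y = mwCount (S.filter fun i => ¬ p i) s y
      + ∑ i ∈ posSet (S.filter p) y,
          ((negSet (S.filter fun i => ¬ p i) y).filter fun j => s j < s i).card
      + ∑ j ∈ negSet (S.filter p) y, ((posSet S y).filter fun i => s j < s i).card := by
  simp only [mwCount_eq_sum, Finset.card_filter]
  rw [Finset.sum_comm (s := negSet (S.filter p) y),
    ← sum_posSet_filter_add S y p, ← sum_posSet_filter_add S y p]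
  simp only [← sum_negSet_filter_add S y p, Finset.sum_add_distrib]
  ring

/-- Proposition 3 (score-bounded selection increases AUC): with
`u = ⌊AUC · p⁻ · n⌋ ≥ 1` and `k = ⌊AUC · n⁺⌋ ≥ 1`, let `θu` be the `u`-th smallest of
the `n` scores and `θl` the `k`-th largest among the scores of the positive instances,
and let the accepted set consist of the instances whose score is *not* in `[θl, θu]`.
If the accepted set contains at least one positive and one negative instance, then the
empirical AUC on the accepted set is at least the empirical AUC of the full sample, and
strictly greater if at least one instance is rejected. -/
theorem prop3_score_bounded_selection [DecidableEq ι]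
    (S : Finset ι) (s : ι → ℝ) (y : ι → Bool)
    (hs : Set.InjOn s S)
    (hpos : 1 ≤ (posSet S y).card) (hneg : 1 ≤ (negSet S y).card)
    (u k : ℤ)
    (hu : u = ⌊auc S s y * (((negSet S y).card : ℝ) / (S.card : ℝ)) * (S.card : ℝ)⌋)
    (hu1 : 1 ≤ u)
    (hk : k = ⌊auc S s y * ((posSet S y).card : ℝ)⌋)
    (hk1 : 1 ≤ k)
    (iu : ι) (hiu : iu ∈ S) (hiurank : (rank' S s iu : ℤ) = u)
    (il : ι) (hil : il ∈ posSet S y) (hilrank : (tcount S s y il : ℤ) = k)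
    (θl θu : ℝ) (hθl : θl = s il) (hθu : θu = s iu)
    (A : Finset ι) (hA : A = S.filter (fun i => ¬ (θl ≤ s i ∧ s i ≤ θu)))
    (hApos : (posSet A y).Nonempty) (hAneg : (negSet A y).Nonempty) :
    auc S s y ≤ auc A s y ∧
      ((∃ i ∈ S, θl ≤ s i ∧ s i ≤ θu) → auc S s y < auc A s y) := by
  subst hA hθl hθu
  have hS : (S.card : ℝ) ≠ 0 := by exact_mod_cast (Finset.card_pos.2 ⟨iu, hiu⟩).ne'
  have hP0 : (0 : ℝ) < (posSet S y).card := by exact_mod_cast hpos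
  have hN0 : (0 : ℝ) < (negSet S y).card := by exact_mod_cast hneg
  have hr : (rank' S s iu : ℝ) ≤ auc S s y * (negSet S y).card := by
    have h1 := Int.floor_le (auc S s y * (((negSet S y).card : ℝ) / S.card) * S.card)
    rwa [← hu, ← hiurank, mul_assoc, div_mul_cancel₀ _ hS, Int.cast_natCast] at h1
  have ht : (tcount S s y il : ℝ) ≤ auc S s y * (posSet S y).card := by
    have h1 := Int.floor_le (auc S s y * ((posSet S y).card : ℝ))
    rwa [← hk, ← hilrank, Int.cast_natCast] at h1
  have haW : auc S s y * ((posSet S y).card * (negSet S y).card) = mwCount S s y :=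
    div_mul_cancel₀ _ (by positivity)
  have hPA := Finset.card_pos.2 hApos
  have hNA := Finset.card_pos.2 hAneg
  have hstrict : (∃ i ∈ S, s il ≤ s i ∧ s i ≤ s iu) →
      auc S s y < auc (S.filter fun i => ¬ (s il ≤ s i ∧ s i ≤ s iu)) s y := by
    rintro ⟨i₀, -, hl₀, hu₀⟩
    have hil' : il ∈ S ∧ y il = true := by simpa [posSet] using hil
    have hp : 0 < (posSet (S.filter fun i => s il ≤ s i ∧ s i ≤ s iu) y).card :=
      Finset.card_pos.2 ⟨il, by simp [posSet, hil', hl₀.trans hu₀]⟩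
    have hP := card_posSet_filter_add S y fun i => s il ≤ s i ∧ s i ≤ s iu
    have hN := sum_negSet_filter_add S y (fun i => s il ≤ s i ∧ s i ≤ s iu) fun _ => 1
    simp only [Finset.sum_const, smul_eq_mul, mul_one] at hN
    have hW := mwCount_eq_filter_add S s y fun i => s il ≤ s i ∧ s i ≤ s iu
    have hc : ∀ i ∈ posSet (S.filter fun i => s il ≤ s i ∧ s i ≤ s iu) y,
        (((negSet (S.filter fun i => ¬ (s il ≤ s i ∧ s i ≤ s iu)) y).filter
          fun j => s j < s i).card : ℝ) ≤ auc S s y * (negSet S y).card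
            - (negSet (S.filter fun i => s il ≤ s i ∧ s i ≤ s iu) y).card - 1 := by
      intro i hi
      have h1 : (_ : ℝ) ≤ _ :=
        Nat.cast_le.2 (card_neg_below_add_le_rank' S s y (s il) iu i hi)
      push_cast at h1
      linarith
    have hd : ∀ j ∈ negSet (S.filter fun i => s il ≤ s i ∧ s i ≤ s iu) y,
        (((posSet S y).filter fun i => s j < s i).card : ℝ)
          ≤ auc S s y * (posSet S y).card := by
      intro j hj
      simp only [negSet, Finset.mem_filter] at hj
      exact (Nat.cast_le.2 (card_pos_above_le_tcount S s y il j hj.1.2.1)).trans ht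
    have hcs := Finset.sum_le_card_nsmul _ _ _ hc
    have hds := Finset.sum_le_card_nsmul _ _ _ hd
    rw [nsmul_eq_mul] at hcs hds
    have ha := auc_le_one S s y
    rw [auc.eq_def (S.filter _), lt_div_iff₀ (by positivity)]
    rify at hP hN hW hp
    simp only [← hP, ← hN] at hcs hds haW
    nlinarith [mul_nonneg (mul_nonneg (sub_nonneg.2 ha)
      (Nat.cast_nonneg (posSet (S.filter fun i => s il ≤ s i ∧ s i ≤ s iu) y).card))
      (Nat.cast_nonneg (α := ℝ)
        (negSet (S.filter fun i => s il ≤ s i ∧ s i ≤ s iu) y).card)]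
  refine ⟨?_, hstrict⟩
  by_cases h : ∃ i ∈ S, s il ≤ s i ∧ s i ≤ s iu
  · exact (hstrict h).le
  · push Not at h
    have hA : S.filter (fun i => ¬ (s il ≤ s i ∧ s i ≤ s iu)) = S :=
      Finset.filter_true_of_mem fun i hi hi' => (h i hi hi'.1).not_ge hi'.2
    rw [hA]
end

section
/- Exact characterization of beneficial positive abstention: Assume n⁺ ≥ 2 and n⁻ ≥ 1, and let i be a positive instance (y(i) = 1). Let c(i) = #{j : y(j) = 0 and s(j) < s(i)} be the number of negative instances with score below s(i). Then the empirical AUC of the sample with i removed is strictly greater than the empirical AUC of the full sample if and only if c(i) < AUC · n⁻, and it is greater than or equal to the AUC of the full sample if and only if c(i) ≤ AUC · n⁻. -/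
open Finset

variable {ι : Type*}

/-- Removing a positive instance lowers the Mann–Whitney count by the number of negative
instances ranked below it. -/
theorem mwCount_erase_add [DecidableEq ι] (S : Finset ι) (s : ι → ℝ) (y : ι → Bool)
    {i : ι} (hi : i ∈ S) (hyi : y i = true) :
    mwCount (S.erase i) s y + (S.filter (fun j => y j = false ∧ s j < s i)).card =
      mwCount S s y := by
  unfold mwCount
  have h := Finset.card_filter_add_card_filter_not
    (s := (S ×ˢ S).filter (fun p => y p.1 = true ∧ y p.2 = false ∧ s p.2 < s p.1))
    (fun p => p.1 ≠ i)
  rw [← h]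
  congr 1
  · congr 1
    ext ⟨a, b⟩
    simp only [mem_filter, mem_product, mem_erase]
    constructor
    · tauto
    · rintro ⟨⟨⟨ha, hb⟩, hya, hyb, hlt⟩, hai⟩
      refine ⟨⟨⟨hai, ha⟩, ?_, hb⟩, hya, hyb, hlt⟩
      rintro rfl
      simp_all
  · refine Finset.card_bij (fun j _ => (i, j)) ?_ ?_ ?_
    · intro j hj
      simp_all
    · intro j _ k _ hjk
      simpa using hjk
    · rintro ⟨a, b⟩ hab
      simp only [mem_filter, mem_product, not_not] at hab
      obtain ⟨⟨⟨_, hb⟩, _, hyb, hlt⟩, rfl⟩ := hab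
      exact ⟨b, by simp [hb, hyb, hlt], rfl⟩

theorem card_posSet_erase_add_one [DecidableEq ι] (S : Finset ι) (y : ι → Bool)
    {i : ι} (hi : i ∈ S) (hyi : y i = true) :
    (posSet (S.erase i) y).card + 1 = (posSet S y).card := by
  rw [posSet, filter_erase]
  exact card_erase_add_one (mem_filter.2 ⟨hi, hyi⟩)

theorem negSet_erase [DecidableEq ι] (S : Finset ι) (y : ι → Bool)
    {i : ι} (hyi : y i = true) : negSet (S.erase i) y = negSet S y := by
  rw [negSet, filter_erase]
  exact erase_eq_of_notMem (by simp [hyi])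

/-- Exact characterization of beneficial positive abstention: for a positive instance `i`,
removing `i` strictly increases the empirical AUC iff `c(i) < AUC · n⁻`, and does not
decrease it iff `c(i) ≤ AUC · n⁻`, where `c(i)` is the number of negative instances with
score below `s i`. -/
theorem exact_positive_abstention [DecidableEq ι] (S : Finset ι) (s : ι → ℝ) (y : ι → Bool)
    (hs : Set.InjOn s S)
    (hpos : 2 ≤ (posSet S y).card) (hneg : 1 ≤ (negSet S y).card)
    (i : ι) (hi : i ∈ S) (hyi : y i = true) :
    (auc S s y < auc (S.erase i) s y ↔
      ((S.filter (fun j => y j = false ∧ s j < s i)).card : ℝ) <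
        auc S s y * ((negSet S y).card : ℝ)) ∧
    (auc S s y ≤ auc (S.erase i) s y ↔
      ((S.filter (fun j => y j = false ∧ s j < s i)).card : ℝ) ≤
        auc S s y * ((negSet S y).card : ℝ)) := by
  have hM := mwCount_erase_add S s y hi hyi
  have hP := card_posSet_erase_add_one S y hi hyi
  have hp : (0 : ℝ) < ((posSet (S.erase i) y).card : ℝ) := by
    exact_mod_cast (by omega : 0 < (posSet (S.erase i) y).card)
  have hn : (0 : ℝ) < ((negSet S y).card : ℝ) := by exact_mod_cast hneg
  simp only [auc, negSet_erase S y hyi, ← hM, ← hP]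
  push_cast
  generalize ((posSet (S.erase i) y).card : ℝ) = p at *
  generalize ((negSet S y).card : ℝ) = n at *
  generalize (mwCount (S.erase i) s y : ℝ) = m at *
  generalize ((S.filter (fun j => y j = false ∧ s j < s i)).card : ℝ) = c at *
  have hp' : 0 < p + 1 := by linarith
  have hA : (m + c) / ((p + 1) * n) * n = (m + c) / (p + 1) := by field_simp
  have hdiff : m / (p * n) - (m + c) / ((p + 1) * n) =
      ((m + c) / (p + 1) - c) / (p * n) := by
    field_simp
    ring
  have hpn := mul_pos hp hn
  rw [hA]
  constructor
  · rw [← sub_pos, hdiff, div_pos_iff_of_pos_right hpn, sub_pos]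
  · rw [← sub_nonneg, hdiff, le_div_iff₀ hpn, zero_mul, sub_nonneg]
end
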